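/- Population bias formula for the fused estimating function when exchangeability may fail (population content of Theorem 1): assume A ≤ R ℙ-almost surely; under ℙ₁ = ℙ(· ∣ R=1), A is conditionally independent of (Y(0), Y(1)) given σ(X); and there is δ ∈ (0, 1/2) with δ ≤ e₁(X) ≤ 1 − δ and π(X) ≥ δ ℙ-almost surely, where e₁(X) is a version of ℙ₁(A=1 ∣ σ(X)) and π(X) a version of ℙ(R=1 ∣ σ(X)). Let e_S(X) be a version of ℙ(A=1 ∣ σ(X)), mₐ(X) a version of 𝔼[Y ∣ X, A=a] under ℙ, μ₀(X) a version of 𝔼[Y ∣ X, A=0] under ℙ₁, and τ = 𝔼[Y(1) − Y(0) ∣ R=1]. Then 𝔼[ (π(X)/q)·{ R·A·(Y − m₁(X))/e_S(X) − (1−A)·(Y − m₀(X))/(1 − e_S(X)) } + (R/q)·( m₁(X) − m₀(X) ) ] − τ = 𝔼[ (R/q)·( μ₀(X) − m₀(X) ) ]. -/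

import Mathlib

open MeasureTheory ProbabilityTheory

/-- Any conditional measure of a finite measure is a finite measure. -/
instance cond_isFiniteMeasure {Ω : Type*} [MeasurableSpace Ω] (μ : Measure Ω)
    [IsFiniteMeasure μ] (s : Set Ω) : IsFiniteMeasure (μ[|s]) := by
  constructor
  rw [ProbabilityTheory.cond, Measure.smul_apply, Measure.restrict_apply MeasurableSet.univ,
    Set.univ_inter, smul_eq_mul]
  exact lt_of_le_of_lt (ENNReal.inv_mul_le_one _) ENNReal.one_lt_top

/-- `v ∘ X` is a version of `𝔼_Q[W ∣ X]` on the event where the (real-valued) indicator `ind`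
equals one: for every bounded measurable `h : ℝ^p → ℝ`,
`𝔼_Q[ind · W · h(X)] = 𝔼_Q[ind · v(X) · h(X)]`.  Versions of conditional expectations
`𝔼_Q[Y ∣ X, A = a]` are obtained with `ind = 1{A=a}` and `W = Y`; versions of conditional
probabilities such as `Q(R=1 ∣ σ(X))` are obtained with `ind = 1` and `W = 1{R=1}`. -/
def IsCondVersion {Ω : Type*} [MeasurableSpace Ω] {p : ℕ} (Q : Measure Ω)
    (X : Ω → Fin p → ℝ) (ind : Ω → ℝ) (W : Ω → ℝ) (v : (Fin p → ℝ) → ℝ) : Prop :=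
  Measurable v ∧ ∀ h : (Fin p → ℝ) → ℝ, Measurable h → (∃ C, ∀ x, |h x| ≤ C) →
    ∫ ω, ind ω * W ω * h (X ω) ∂Q = ∫ ω, ind ω * v (X ω) * h (X ω) ∂Q

open Filter Topology

lemma cv_ext {Ω : Type*} [MeasurableSpace Ω] {p : ℕ} (Q : Measure Ω) [IsFiniteMeasure Q]
    (X : Ω → Fin p → ℝ) (hX : Measurable X) (ind W : Ω → ℝ) (v : (Fin p → ℝ) → ℝ)
    (hind : Measurable ind) (hind01 : ∀ ω, ind ω = 0 ∨ ind ω = 1)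
    (hv : IsCondVersion Q X ind W v) (g : (Fin p → ℝ) → ℝ) (hg : Measurable g)
    (hi : Integrable (fun ω => ind ω * W ω * g (X ω)) Q) :
    Integrable (fun ω => ind ω * v (X ω) * g (X ω)) Q ∧
    ∫ ω, ind ω * W ω * g (X ω) ∂Q = ∫ ω, ind ω * v (X ω) * g (X ω) ∂Q := by
  obtain ⟨hvm, hv⟩ := hv
  let s : ℕ → Set (Fin p → ℝ) := fun n => {x | |v x| ≤ n ∧ |g x| ≤ n}
  have hs : ∀ n, MeasurableSet (s n) := fun n =>
    (measurableSet_le hvm.abs measurable_const).inter (measurableSet_le hg.abs measurable_const)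
  have hφ : AECover Q atTop (fun n => X ⁻¹' s n) := by
    refine ⟨Eventually.of_forall fun ω => ?_, fun n => hX (hs n)⟩
    obtain ⟨a, ha⟩ := exists_nat_ge |v (X ω)|
    obtain ⟨b, hb⟩ := exists_nat_ge |g (X ω)|
    filter_upwards [eventually_ge_atTop a, eventually_ge_atTop b] with n h1 h2
    exact ⟨ha.trans (by exact_mod_cast h1), hb.trans (by exact_mod_cast h2)⟩
  have hind0 : ∀ ω, 0 ≤ ind ω ∧ ind ω ≤ 1 := fun ω => by rcases hind01 ω with h | h <;> simp [h]
  have hvX : Measurable fun ω => v (X ω) := hvm.comp hX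
  have hgX : Measurable fun ω => g (X ω) := hg.comp hX
  have hm2 : Measurable fun ω => ind ω * v (X ω) * g (X ω) := (hind.mul hvX).mul hgX
  have hint : ∀ n, IntegrableOn (fun ω => ind ω * v (X ω) * g (X ω)) (X ⁻¹' s n) Q := by
    intro n
    refine Measure.integrableOn_of_bounded (M := (n:ℝ) * n) (measure_ne_top _ _)
      hm2.aestronglyMeasurable ?_
    refine (ae_restrict_iff' (hX (hs n))).2 (Eventually.of_forall fun ω hω => ?_)
    rw [Real.norm_eq_abs, abs_mul, abs_mul, abs_of_nonneg (hind0 ω).1]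
    have h1 : |v (X ω)| ≤ n := hω.1
    have h2 : |g (X ω)| ≤ n := hω.2
    have : ind ω * |v (X ω)| ≤ n := by
      nlinarith [abs_nonneg (v (X ω)), (hind0 ω).2, (hind0 ω).1]
    gcongr
  have key : Integrable (fun ω => ind ω * v (X ω) * g (X ω)) Q := by
    refine hφ.integrable_of_integral_norm_bounded (∫ ω, ‖ind ω * W ω * g (X ω)‖ ∂Q) hint
      (Eventually.of_forall fun n => ?_)
    let sg : (Fin p → ℝ) → ℝ := fun x => if 0 ≤ v x then 1 else -1
    have hsg' : Measurable sg :=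
      Measurable.ite (measurableSet_le measurable_const hvm) measurable_const measurable_const
    have hsb : ∀ x, |sg x| ≤ 1 := by
      intro x
      simp only [sg]
      split_ifs <;> simp
    have hsv : ∀ x, v x * sg x = |v x| := by
      intro x
      simp only [sg]
      split_ifs with h
      · rw [abs_of_nonneg h, mul_one]
      · rw [abs_of_neg (not_le.1 h)]; ring
    have h := hv ((s n).indicator fun x => sg x * |g x|)
      ((hsg'.mul hg.abs).indicator (hs n)) ⟨n, fun x => by
        by_cases hx : x ∈ s n
        · rw [Set.indicator_of_mem hx, abs_mul, abs_abs]
          have := hx.2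
          nlinarith [hsb x, abs_nonneg (g x)]
        · rw [Set.indicator_of_notMem hx]; simp⟩
    rw [← integral_indicator (hX (hs n))]
    have e : (∫ ω, (X ⁻¹' s n).indicator (fun ω => ‖ind ω * v (X ω) * g (X ω)‖) ω ∂Q)
      = ∫ ω, ind ω * v (X ω) * (s n).indicator (fun x => sg x * |g x|) (X ω) ∂Q := by
      congr 1; ext ω
      by_cases hx : X ω ∈ s n
      · rw [Set.indicator_of_mem hx, Set.indicator_of_mem (by exact hx), Real.norm_eq_abs, abs_mul,
          abs_mul, abs_of_nonneg (hind0 ω).1, ← hsv (X ω)]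
        ring
      · rw [Set.indicator_of_notMem hx, Set.indicator_of_notMem (by exact hx)]; simp
    rw [e, ← h]
    refine (le_abs_self _).trans ?_
    rw [← Real.norm_eq_abs]
    refine (norm_integral_le_integral_norm _).trans ?_
    refine integral_mono_of_nonneg (Eventually.of_forall fun _ => norm_nonneg _) hi.norm
      (Eventually.of_forall fun ω => ?_)
    simp only [norm_mul]
    gcongr
    by_cases hx : X ω ∈ s n
    · rw [Set.indicator_of_mem hx, norm_mul, Real.norm_eq_abs, Real.norm_eq_abs, abs_abs]
      have := hsb (X ω)
      rw [Real.norm_eq_abs]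
      nlinarith [abs_nonneg (g (X ω))]
    · rw [Set.indicator_of_notMem hx]; simp
  refine ⟨key, ?_⟩
  have t1 := hφ.integral_tendsto_of_countably_generated hi
  have t2 := hφ.integral_tendsto_of_countably_generated key
  refine tendsto_nhds_unique t1 (t2.congr fun n => ?_)
  have h := hv ((s n).indicator g) (hg.indicator (hs n)) ⟨n, fun x => by
    by_cases hx : x ∈ s n
    · rw [Set.indicator_of_mem hx]; exact hx.2
    · rw [Set.indicator_of_notMem hx]; simp⟩
  rw [← integral_indicator (hX (hs n)), ← integral_indicator (hX (hs n))]
  convert h.symm using 2 <;>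
  · ext ω
    by_cases hx : X ω ∈ s n
    · rw [Set.indicator_of_mem hx, Set.indicator_of_mem (by exact hx)]
    · rw [Set.indicator_of_notMem hx, Set.indicator_of_notMem (by exact hx)]; simp

lemma cv_condExp {Ω : Type*} [MeasurableSpace Ω] {p : ℕ} (Q : Measure Ω) [IsFiniteMeasure Q]
    (X : Ω → Fin p → ℝ) (hX : Measurable X) (W : Ω → ℝ) (v : (Fin p → ℝ) → ℝ)
    (hW : Integrable W Q)
    (hv : IsCondVersion Q X (fun _ => 1) W v) :
    (fun ω => v (X ω)) =ᵐ[Q] Q[W | MeasurableSpace.comap X inferInstance] := by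
  have hi := (cv_ext Q X hX (fun _ => 1) W v measurable_const (fun _ => Or.inr rfl) hv
    (fun _ => 1) measurable_const (by simpa using hW)).1
  have hi' : Integrable (fun ω => v (X ω)) Q := by simpa using hi
  refine ae_eq_condExp_of_forall_setIntegral_eq hX.comap_le hW (fun s _ _ => hi'.integrableOn) ?_ ?_
  · rintro s ⟨t, ht, rfl⟩ -
    have h := hv.2 (t.indicator 1) (measurable_one.indicator ht) ⟨1, fun x => by
      by_cases hx : x ∈ t <;> simp [hx]⟩
    rw [← integral_indicator (hX ht), ← integral_indicator (hX ht)]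
    convert h.symm using 2 <;>
    · ext ω
      by_cases hx : X ω ∈ t <;> simp [hx]
  · exact (hv.1.comp (comap_measurable X)).aestronglyMeasurable

lemma ci_int {Ω : Type*} [MeasurableSpace Ω] [StandardBorelSpace Ω] {p : ℕ} (Q : Measure Ω)
    [IsFiniteMeasure Q] (X : Ω → Fin p → ℝ) (hX : Measurable X) (A Z B : Ω → ℝ)
    (hA : Measurable A) (hZ : Measurable Z)
    (hCI : CondIndepFun (MeasurableSpace.comap X inferInstance) hX.comap_le A Z Q)
    (S : Set ℝ) (hS : MeasurableSet S) (hB : B = (A ⁻¹' S).indicator (fun _ => 1))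
    (b : (Fin p → ℝ) → ℝ) (hb : IsCondVersion Q X (fun _ => 1) B b)
    (δ : ℝ) (hδ : 0 < δ) (hbδ : ∀ᵐ ω ∂Q, δ ≤ b (X ω)) :
    ∫ ω, B ω * Z ω * (b (X ω))⁻¹ ∂Q = ∫ ω, Z ω ∂Q := by
  have hBm : Measurable B := by rw [hB]; exact measurable_const.indicator (hA hS)
  have hB0 : ∀ ω, 0 ≤ B ω := fun ω => by
    rw [hB]; exact Set.indicator_nonneg (fun _ _ => zero_le_one) _
  have hB1 : ∀ ω, B ω ≤ 1 := fun ω => by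
    rw [hB]; exact Set.indicator_le' (fun _ _ => le_rfl) (fun _ _ => zero_le_one) _
  have hBi : Integrable B Q := Integrable.of_bound hBm.aestronglyMeasurable 1
    (Eventually.of_forall fun ω => by rw [Real.norm_eq_abs, abs_of_nonneg (hB0 ω)]; exact hB1 ω)
  have hbX : Measurable fun ω => b (X ω) := hb.1.comp hX
  have hbc := cv_condExp Q X hX B b hBi hb
  have hbinv : ∀ᵐ ω ∂Q, ‖(b (X ω))⁻¹‖ ≤ δ⁻¹ := by
    filter_upwards [hbδ] with ω h
    rw [norm_inv, Real.norm_eq_abs, abs_of_pos (hδ.trans_le h)]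
    gcongr
  have hmeas : (Q.withDensity (fun ω => ENNReal.ofReal (B ω * (b (X ω))⁻¹))).map Z = Q.map Z := by
    ext t ht
    rw [Measure.map_apply hZ ht, Measure.map_apply hZ ht, withDensity_apply _ (hZ ht)]
    have hci := (condIndepFun_iff_condExp_inter_preimage_eq_mul hA hZ).1 hCI S t hS ht
    let T : Ω → ℝ := (Z ⁻¹' t).indicator fun _ => 1
    have hTi : Integrable T Q := (integrable_const 1).indicator (hZ ht)
    have hBT : (A ⁻¹' S ∩ Z ⁻¹' t).indicator (fun _ => (1:ℝ)) = B * T := by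
      ext ω; rw [hB]; by_cases h1 : ω ∈ A ⁻¹' S <;> by_cases h2 : ω ∈ Z ⁻¹' t <;>
        simp [T, Set.indicator, h1, h2]
    rw [hBT, ← hB] at hci
    have hBTi : Integrable (B * T) Q := by
      rw [← hBT]; exact (integrable_const 1).indicator ((hA hS).inter (hZ ht))
    have hpull := condExp_stronglyMeasurable_mul_of_bound hX.comap_le
      (f := fun ω => (b (X ω))⁻¹)
      ((hb.1.comp (comap_measurable X)).inv.stronglyMeasurable) hBTi _ hbinv
    have hint : Integrable ((fun ω => (b (X ω))⁻¹) * (B * T)) Q :=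
      hBTi.bdd_mul hbX.inv.aestronglyMeasurable hbinv
    have hE : ∫ ω, ((fun ω => (b (X ω))⁻¹) * (B * T)) ω ∂Q = ∫ ω, T ω ∂Q := by
      rw [← integral_condExp hX.comap_le, ← integral_condExp hX.comap_le (f := T)]
      refine integral_congr_ae ?_
      filter_upwards [hpull, hci, hbc, hbδ] with ω h1 h2 h3 h4
      rw [h1, Pi.mul_apply, h2, ← h3]
      have : b (X ω) ≠ 0 := (hδ.trans_le h4).ne'
      field_simp
      rfl
    rw [← lintegral_indicator (hZ ht), ← ofReal_measureReal, ← integral_indicator_one (hZ ht)]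
    change _ = ENNReal.ofReal (∫ ω, T ω ∂Q)
    rw [← hE, ofReal_integral_eq_lintegral_ofReal hint]
    · refine lintegral_congr fun ω => ?_
      by_cases h : ω ∈ Z ⁻¹' t
      · simp [T, h, mul_comm]
      · simp [T, h]
    · filter_upwards [hbδ] with ω h
      have h0 : 0 ≤ T ω := Set.indicator_nonneg (fun _ _ => zero_le_one) _
      have h1 := hB0 ω
      have h2 := hδ.trans_le h
      simp only [Pi.mul_apply, Pi.zero_apply]
      positivity
  have h1 := integral_map (μ := Q) hZ.aemeasurable (f := fun z : ℝ => z)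
    measurable_id.aestronglyMeasurable
  have h2 := integral_map (μ := Q.withDensity (fun ω => ENNReal.ofReal (B ω * (b (X ω))⁻¹)))
    hZ.aemeasurable (f := fun z : ℝ => z) measurable_id.aestronglyMeasurable
  rw [← h1, ← hmeas, h2,
    integral_withDensity_eq_integral_toReal_smul (show Measurable (fun ω => ENNReal.ofReal (B ω * (b (X ω))⁻¹)) from
      (hBm.mul hbX.inv).ennreal_ofReal) (by simp)]
  refine integral_congr_ae ?_
  filter_upwards [hbδ] with ω h
  have h2 := hδ.trans_le h
  rw [ENNReal.toReal_ofReal (mul_nonneg (hB0 ω) (by positivity))]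
  simp only [smul_eq_mul]; ring

/-- Population bias formula for the fused estimating function when
exchangeability may fail (population content of Theorem 1). -/
theorem fused_bias_formula {Ω : Type*} [MeasurableSpace Ω] [StandardBorelSpace Ω] [Nonempty Ω]
    (P : Measure Ω) [IsProbabilityMeasure P]
    (p : ℕ) (hp : 1 ≤ p)
    (X : Ω → Fin p → ℝ) (hX : Measurable X)
    (A R : Ω → ℝ) (hA : Measurable A) (hR : Measurable R)
    (hA01 : ∀ ω, A ω = 0 ∨ A ω = 1) (hR01 : ∀ ω, R ω = 0 ∨ R ω = 1)
    -- external-control units are never treated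
    (hAR : ∀ᵐ ω ∂P, A ω ≤ R ω)
    (Y0 Y1 : Ω → ℝ) (hY0m : Measurable Y0) (hY1m : Measurable Y1)
    (hY0 : Integrable Y0 P) (hY1 : Integrable Y1 P)
    (Y : Ω → ℝ) (hY : ∀ ω, Y ω = A ω * Y1 ω + (1 - A ω) * Y0 ω)
    (q : ℝ) (hq : P {ω | R ω = 1} = ENNReal.ofReal q) (hq0 : 0 < q) (hq1 : q < 1)
    -- strong ignorability: A ⫫ (Y(0), Y(1)) ∣ σ(X) under P₁ = P(⬝ ∣ R = 1)
    (hCI : CondIndepFun (MeasurableSpace.comap X inferInstance) hX.comap_le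
      A (fun ω => (Y0 ω, Y1 ω)) (P[|{ω | R ω = 1}]))
    -- overlap: δ ≤ e₁(X) ≤ 1 − δ and π(X) ≥ δ, P-a.s.
    (δ : ℝ) (hδ : δ ∈ Set.Ioo (0 : ℝ) (1 / 2))
    (e₁ : (Fin p → ℝ) → ℝ)
    (he₁ : IsCondVersion (P[|{ω | R ω = 1}]) X (fun _ => 1) A e₁)
    (π : (Fin p → ℝ) → ℝ) (hπ : IsCondVersion P X (fun _ => 1) R π)
    (hbd : ∀ᵐ ω ∂P, (δ ≤ e₁ (X ω) ∧ e₁ (X ω) ≤ 1 - δ) ∧ δ ≤ π (X ω))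
    -- pooled propensity score and pooled outcome regressions
    (eS : (Fin p → ℝ) → ℝ) (heS : IsCondVersion P X (fun _ => 1) A eS)
    (m₀ m₁ : (Fin p → ℝ) → ℝ)
    (hm₀ : IsCondVersion P X (fun ω => 1 - A ω) Y m₀)
    (hm₁ : IsCondVersion P X A Y m₁)
    -- control-outcome regression in the RCT population
    (μ₀ : (Fin p → ℝ) → ℝ)
    (hμ₀ : IsCondVersion (P[|{ω | R ω = 1}]) X (fun ω => 1 - A ω) Y μ₀)
    -- the ATE in the RCT population
    (τ : ℝ) (hτ : τ = ∫ ω, (Y1 ω - Y0 ω) ∂(P[|{ω | R ω = 1}])) :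
    (∫ ω, (π (X ω) / q * (R ω * A ω * (Y ω - m₁ (X ω)) / eS (X ω)
            - (1 - A ω) * (Y ω - m₀ (X ω)) / (1 - eS (X ω)))
          + R ω / q * (m₁ (X ω) - m₀ (X ω))) ∂P) - τ =
      ∫ ω, R ω / q * (μ₀ (X ω) - m₀ (X ω)) ∂P := by
  obtain ⟨hδ0, hδ2⟩ := hδ
  have hRs : MeasurableSet {ω | R ω = 1} := hR (measurableSet_singleton 1)
  have hcond : ∀ f : Ω → ℝ, ∫ ω, f ω ∂(P[|{ω | R ω = 1}]) = q⁻¹ * ∫ ω, R ω * f ω ∂P := by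
    intro f
    rw [ProbabilityTheory.cond, integral_smul_measure, hq, ← integral_indicator hRs,
      ENNReal.toReal_inv, ENNReal.toReal_ofReal hq0.le, smul_eq_mul]
    congr 2
    ext ω
    rcases hR01 ω with h | h <;> simp [Set.indicator, h]
  have hac : P[|{ω | R ω = 1}] ≪ P := cond_absolutelyContinuous
  have hint1 : ∀ f : Ω → ℝ, Integrable f P → Integrable f (P[|{ω | R ω = 1}]) := by
    intro f hf
    rw [ProbabilityTheory.cond]
    refine hf.restrict.smul_measure ?_
    rw [hq]
    simp [hq0]
  set P1 : Measure Ω := P[|{ω | R ω = 1}] with hP1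
  have hA0 : ∀ ω, 0 ≤ A ω ∧ A ω ≤ 1 := fun ω => by rcases hA01 ω with h | h <;> simp [h]
  have hR0 : ∀ ω, 0 ≤ R ω ∧ R ω ≤ 1 := fun ω => by rcases hR01 ω with h | h <;> simp [h]
  have hbnd : ∀ (Q : Measure Ω) (c f : Ω → ℝ) (C : ℝ), Integrable f Q → Measurable c →
      (∀ᵐ ω ∂Q, |c ω| ≤ C) → Integrable (fun ω => c ω * f ω) Q := by
    intro Q c f C hf hc hC
    exact hf.bdd_mul hc.aestronglyMeasurable hC
  have hAabs : ∀ Q : Measure Ω, ∀ᵐ ω ∂Q, |A ω| ≤ 1 := fun Q => Eventually.of_forall fun ω => by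
    rw [abs_of_nonneg (hA0 ω).1]; exact (hA0 ω).2
  have hRabs : ∀ Q : Measure Ω, ∀ᵐ ω ∂Q, |R ω| ≤ 1 := fun Q => Eventually.of_forall fun ω => by
    rw [abs_of_nonneg (hR0 ω).1]; exact (hR0 ω).2
  have hA'abs : ∀ Q : Measure Ω, ∀ᵐ ω ∂Q, |1 - A ω| ≤ 1 := fun Q =>
    Eventually.of_forall fun ω => by
      rw [abs_le]; constructor <;> linarith [(hA0 ω).1, (hA0 ω).2]
  have hA'm : Measurable fun ω => 1 - A ω := measurable_const.sub hA
  have hA'01 : ∀ ω, 1 - A ω = 0 ∨ 1 - A ω = 1 := fun ω => by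
    rcases hA01 ω with h | h <;> simp [h]
  have hAY : ∀ ω, A ω * Y ω = A ω * Y1 ω := fun ω => by
    rw [hY]; rcases hA01 ω with h | h <;> simp [h]
  have hA'Y : ∀ ω, (1 - A ω) * Y ω = (1 - A ω) * Y0 ω := fun ω => by
    rw [hY]; rcases hA01 ω with h | h <;> simp [h]
  have hAi : Integrable A P := Integrable.of_bound hA.aestronglyMeasurable 1 (hAabs P)
  have hRi : Integrable R P := Integrable.of_bound hR.aestronglyMeasurable 1 (hRabs P)
  have hAYi : Integrable (fun ω => A ω * Y ω) P := by
    simp only [hAY]; exact hbnd P A Y1 1 hY1 hA (hAabs P)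
  have hA'Yi : Integrable (fun ω => (1 - A ω) * Y ω) P := by
    simp only [hA'Y]; exact hbnd P _ Y0 1 hY0 hA'm (hA'abs P)
  have he₁X : Measurable fun ω => e₁ (X ω) := he₁.1.comp hX
  have hπX : Measurable fun ω => π (X ω) := hπ.1.comp hX
  have heSX : Measurable fun ω => eS (X ω) := heS.1.comp hX
  have hm₀X : Measurable fun ω => m₀ (X ω) := hm₀.1.comp hX
  have hm₁X : Measurable fun ω => m₁ (X ω) := hm₁.1.comp hX
  have hμ₀X : Measurable fun ω => μ₀ (X ω) := hμ₀.1.comp hX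
  -- eliminate `R * A`
  have hRA : ∀ᵐ ω ∂P, R ω * A ω = A ω := by
    filter_upwards [hAR] with ω h
    rcases hA01 ω with h1 | h1 <;> rcases hR01 ω with h2 | h2 <;>
      simp only [h1, h2] at h ⊢ <;> first | norm_num; done | (exfalso; linarith)
  -- a.s. facts on π
  have hπ1 : ∀ᵐ ω ∂P, π (X ω) ≤ 1 := by
    have h1 := cv_condExp P X hX R π hRi hπ
    have h2 := condExp_mono (m := MeasurableSpace.comap X inferInstance) hRi
      (integrable_const (1:ℝ)) (Eventually.of_forall fun ω => (hR0 ω).2)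
    rw [condExp_const hX.comap_le] at h2
    filter_upwards [h1, h2] with ω h1 h2
    rw [h1]; exact h2
  have hebd : ∀ᵐ ω ∂P, |e₁ (X ω)| ≤ 1 := by
    filter_upwards [hbd] with ω h
    rw [abs_le]; constructor <;> linarith [h.1.1, h.1.2]
  have heSv : IsCondVersion P X (fun _ => 1) A (fun x => π x * e₁ x) := by
    refine ⟨hπ.1.mul he₁.1, fun h hh hC => ?_⟩
    obtain ⟨C, hC⟩ := hC
    have hhX : Measurable fun ω => h (X ω) := hh.comp hX
    have k1 := he₁.2 h hh ⟨C, hC⟩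
    rw [hcond, hcond] at k1
    have k2 := mul_left_cancel₀ (inv_ne_zero hq0.ne') k1
    have k3 := (cv_ext P X hX (fun _ => 1) R π measurable_const (fun _ => Or.inr rfl) hπ
      (fun x => e₁ x * h x) (he₁.1.mul hh) (by
        have := hbnd P (fun ω => R ω) (fun ω => e₁ (X ω) * h (X ω)) 1
          (hbnd P _ _ 1 (Integrable.of_bound hhX.aestronglyMeasurable C
            (Eventually.of_forall fun ω => hC _)) he₁X hebd) hR (hRabs P)
        simpa using this)).2
    calc ∫ ω, 1 * A ω * h (X ω) ∂P = ∫ ω, R ω * (1 * A ω * h (X ω)) ∂P := by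
          refine integral_congr_ae ?_
          filter_upwards [hRA] with ω hω
          linear_combination (-h (X ω)) * hω
      _ = ∫ ω, R ω * (1 * e₁ (X ω) * h (X ω)) ∂P := k2
      _ = ∫ ω, 1 * R ω * (e₁ (X ω) * h (X ω)) ∂P := by
          congr 1; ext ω; ring
      _ = _ := by
          rw [k3]; congr 1; ext ω; ring
  have heSeq : ∀ᵐ ω ∂P, eS (X ω) = π (X ω) * e₁ (X ω) := by
    filter_upwards [cv_condExp P X hX A eS hAi heS, cv_condExp P X hX A _ hAi heSv] with ω h1 h2
    rw [h1, h2]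
  have hall : ∀ᵐ ω ∂P, δ ≤ e₁ (X ω) ∧ e₁ (X ω) ≤ 1 - δ ∧ δ ≤ π (X ω) ∧ π (X ω) ≤ 1 ∧
      eS (X ω) = π (X ω) * e₁ (X ω) ∧ δ * δ ≤ eS (X ω) ∧ δ ≤ 1 - eS (X ω) := by
    filter_upwards [hbd, hπ1, heSeq] with ω h1 h2 h3
    refine ⟨h1.1.1, h1.1.2, h1.2, h2, h3, ?_, ?_⟩
    · rw [h3]; nlinarith [h1.1.1, h1.2]
    · rw [h3]; nlinarith [h1.1.1, h1.1.2, h1.2]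
  -- generic division
  have hdiv : ∀ (Q : Measure Ω) (b f : Ω → ℝ) (d : ℝ), 0 < d → Measurable b →
      (∀ᵐ ω ∂Q, d ≤ b ω) → Integrable (fun ω => b ω * f ω) Q → Integrable f Q := by
    intro Q b f d hd hb hbd hi
    have := hbnd Q (fun ω => (b ω)⁻¹) _ d⁻¹ hi hb.inv (by
      filter_upwards [hbd] with ω h
      rw [abs_inv, abs_of_pos (hd.trans_le h)]; gcongr)
    refine this.congr ?_
    filter_upwards [hbd] with ω h
    have := (hd.trans_le h).ne'
    field_simp
  have comp : ∀ (Q : Measure Ω) [IsFiniteMeasure Q] (e : (Fin p → ℝ) → ℝ),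
      Integrable A Q → IsCondVersion Q X (fun _ => 1) A e →
      IsCondVersion Q X (fun _ => 1) (fun ω => 1 - A ω) (fun x => 1 - e x) := by
    intro Q _ e hAi he
    refine ⟨measurable_const.sub he.1, fun h hh hC => ?_⟩
    obtain ⟨C, hC⟩ := hC
    have hhX : Measurable fun ω => h (X ω) := hh.comp hX
    have hhi : Integrable (fun ω => h (X ω)) Q :=
      Integrable.of_bound hhX.aestronglyMeasurable C (Eventually.of_forall fun ω => hC _)
    have i1 : Integrable (fun ω => 1 * A ω * h (X ω)) Q := by
      simpa using hbnd Q A _ 1 hhi hA (hAabs Q)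
    obtain ⟨i2, k⟩ := cv_ext Q X hX (fun _ => 1) A e measurable_const (fun _ => Or.inr rfl) he h hh i1
    have r1 : (fun ω => 1 * (1 - A ω) * h (X ω)) = fun ω => h (X ω) - 1 * A ω * h (X ω) := by
      ext ω; ring
    have r2 : (fun ω => 1 * (1 - e (X ω)) * h (X ω)) = fun ω => h (X ω) - 1 * e (X ω) * h (X ω) := by
      ext ω; ring
    rw [r1, r2, integral_sub hhi i1, integral_sub hhi i2, k]
  have heS' := comp P eS hAi heS
  have hAi1 : Integrable A P1 := hint1 _ hAi
  have he₁' := comp P1 e₁ hAi1 he₁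
  -- integrability of the regressions
  have hAm₁ : Integrable (fun ω => A ω * m₁ (X ω)) P := by
    simpa using (cv_ext P X hX A Y m₁ hA hA01 hm₁ (fun _ => 1) measurable_const
      (by simpa using hAYi)).1
  have hA'm₀ : Integrable (fun ω => (1 - A ω) * m₀ (X ω)) P := by
    simpa using (cv_ext P X hX _ Y m₀ hA'm hA'01 hm₀ (fun _ => 1) measurable_const
      (by simpa using hA'Yi)).1
  have hA'μ₀ : Integrable (fun ω => (1 - A ω) * μ₀ (X ω)) P1 := by
    simpa using (cv_ext P1 X hX _ Y μ₀ hA'm hA'01 hμ₀ (fun _ => 1) measurable_const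
      (by simpa using hint1 _ hA'Yi)).1
  have hm₁i : Integrable (fun ω => m₁ (X ω)) P := by
    refine hdiv P _ _ (δ * δ) (by positivity) heSX (hall.mono fun ω h => h.2.2.2.2.2.1) ?_
    simpa using (cv_ext P X hX (fun _ => 1) A eS measurable_const (fun _ => Or.inr rfl) heS
      m₁ hm₁.1 (by simpa using hAm₁)).1
  have hm₀i : Integrable (fun ω => m₀ (X ω)) P := by
    refine hdiv P (fun ω => 1 - eS (X ω)) _ δ hδ0 (measurable_const.sub heSX)
      (hall.mono fun ω h => h.2.2.2.2.2.2) ?_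
    simpa using (cv_ext P X hX (fun _ => 1) _ _ measurable_const (fun _ => Or.inr rfl) heS'
      m₀ hm₀.1 (by simpa using hA'm₀)).1
  have hall1 : ∀ᵐ ω ∂P1, δ ≤ e₁ (X ω) ∧ δ ≤ 1 - e₁ (X ω) :=
    hac.ae_le (hall.mono fun ω h => ⟨h.1, by linarith [h.2.1]⟩)
  have hμ₀i : Integrable (fun ω => μ₀ (X ω)) P1 := by
    refine hdiv P1 (fun ω => 1 - e₁ (X ω)) _ δ hδ0 (measurable_const.sub he₁X)
      (hall1.mono fun ω h => h.2) ?_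
    simpa using (cv_ext P1 X hX (fun _ => 1) _ _ measurable_const (fun _ => Or.inr rfl) he₁'
      μ₀ hμ₀.1 (by simpa using hA'μ₀)).1
  have hinvb : ∀ (Q : Measure Ω) (b : Ω → ℝ), (∀ᵐ ω ∂Q, δ ≤ b ω) →
      ∀ᵐ ω ∂Q, |(b ω)⁻¹| ≤ δ⁻¹ := by
    intro Q b hb
    filter_upwards [hb] with ω h
    rw [abs_inv, abs_of_pos (hδ0.trans_le h)]; gcongr
  -- E₁[μ₀] = E₁[Y0]
  have hE0 : ∫ ω, μ₀ (X ω) ∂P1 = ∫ ω, Y0 ω ∂P1 := by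
    have hCI0 := hCI.comp (measurable_id) (measurable_fst)
    have c := ci_int P1 X hX A Y0 (fun ω => 1 - A ω) hA hY0m hCI0 {0} (measurableSet_singleton 0)
      (by ext ω; rcases hA01 ω with h | h <;> simp [Set.indicator, h]) _ he₁' δ hδ0
      (hall1.mono fun ω h => h.2)
    have gm : Measurable fun x => (1 - e₁ x)⁻¹ := (measurable_const.sub he₁.1).inv
    have hb := hinvb P1 (fun ω => 1 - e₁ (X ω)) (hall1.mono fun ω h => h.2)
    obtain ⟨i1, k1⟩ := cv_ext P1 X hX _ Y μ₀ hA'm hA'01 hμ₀ (fun x => (1 - e₁ x)⁻¹) gm (by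
      simpa [mul_comm] using hbnd P1 _ _ _ (hint1 _ hA'Yi) (gm.comp hX) hb)
    obtain ⟨i2, k2⟩ := cv_ext P1 X hX (fun _ => 1) _ _ measurable_const (fun _ => Or.inr rfl) he₁'
      (fun x => μ₀ x * (1 - e₁ x)⁻¹) (hμ₀.1.mul gm) (by simpa [mul_assoc] using i1)
    rw [← c]
    calc ∫ ω, μ₀ (X ω) ∂P1
        = ∫ ω, 1 * (1 - e₁ (X ω)) * (μ₀ (X ω) * (1 - e₁ (X ω))⁻¹) ∂P1 := by
          refine integral_congr_ae ?_
          filter_upwards [hall1] with ω h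
          have := (hδ0.trans_le h.2).ne'
          field_simp
      _ = ∫ ω, 1 * (1 - A ω) * (μ₀ (X ω) * (1 - e₁ (X ω))⁻¹) ∂P1 := k2.symm
      _ = ∫ ω, (1 - A ω) * μ₀ (X ω) * (1 - e₁ (X ω))⁻¹ ∂P1 := by
          congr 1; ext ω; ring
      _ = ∫ ω, (1 - A ω) * Y ω * (1 - e₁ (X ω))⁻¹ ∂P1 := k1.symm
      _ = _ := by simp only [hA'Y]
  -- E₁[m₁] = E₁[Y1]
  have hE1 : ∫ ω, m₁ (X ω) ∂P1 = ∫ ω, Y1 ω ∂P1 := by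
    have hCI1 := hCI.comp (measurable_id) (measurable_snd)
    have c := ci_int P1 X hX A Y1 A hA hY1m hCI1 {1} (measurableSet_singleton 1)
      (by ext ω; rcases hA01 ω with h | h <;> simp [Set.indicator, h]) _ he₁ δ hδ0
      (hall1.mono fun ω h => h.1)
    have gm : Measurable fun x => (e₁ x)⁻¹ := he₁.1.inv
    have hb := hinvb P (fun ω => e₁ (X ω)) (hall.mono fun ω h => h.1)
    obtain ⟨i1, k1⟩ := cv_ext P X hX _ Y m₁ hA hA01 hm₁ (fun x => (e₁ x)⁻¹) gm (by
      simpa [mul_comm] using hbnd P _ _ _ hAYi (gm.comp hX) hb)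
    obtain ⟨i2, k2⟩ := cv_ext P1 X hX (fun _ => 1) _ _ measurable_const (fun _ => Or.inr rfl) he₁
      (fun x => m₁ x * (e₁ x)⁻¹) (hm₁.1.mul gm) (by simpa [mul_assoc] using hint1 _ i1)
    rw [← c]
    calc ∫ ω, m₁ (X ω) ∂P1
        = ∫ ω, 1 * e₁ (X ω) * (m₁ (X ω) * (e₁ (X ω))⁻¹) ∂P1 := by
          refine integral_congr_ae ?_
          filter_upwards [hall1] with ω h
          have := (hδ0.trans_le h.1).ne'
          field_simp
      _ = ∫ ω, 1 * A ω * (m₁ (X ω) * (e₁ (X ω))⁻¹) ∂P1 := k2.symm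
      _ = q⁻¹ * ∫ ω, A ω * m₁ (X ω) * (e₁ (X ω))⁻¹ ∂P := by
          rw [hcond]
          congr 1
          refine integral_congr_ae ?_
          filter_upwards [hRA] with ω h
          linear_combination (m₁ (X ω) * (e₁ (X ω))⁻¹) * h
      _ = q⁻¹ * ∫ ω, A ω * Y ω * (e₁ (X ω))⁻¹ ∂P := by rw [k1]
      _ = ∫ ω, A ω * Y1 ω * (e₁ (X ω))⁻¹ ∂P1 := by
          rw [hcond]
          congr 1
          refine integral_congr_ae ?_
          filter_upwards [hRA] with ω h
          rw [hAY]
          linear_combination -(Y1 ω * (e₁ (X ω))⁻¹) * h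
  -- the two augmentation terms vanish
  have g1m : Measurable fun x => π x / q * (eS x)⁻¹ := (hπ.1.div_const q).mul heS.1.inv
  have g0m : Measurable fun x => π x / q * (1 - eS x)⁻¹ :=
    (hπ.1.div_const q).mul (measurable_const.sub heS.1).inv
  have g1b : ∀ᵐ ω ∂P, |π (X ω) / q * (eS (X ω))⁻¹| ≤ 1 / q * (δ * δ)⁻¹ := by
    filter_upwards [hall] with ω h
    obtain ⟨-, -, h1, h2, -, h3, h4⟩ := h
    have h5 : 0 < δ * δ := by positivity
    have h6 : 0 < π (X ω) := hδ0.trans_le h1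
    have h7 : 0 < eS (X ω) := h5.trans_le h3
    rw [abs_of_pos (by positivity)]
    gcongr
  have g0b : ∀ᵐ ω ∂P, |π (X ω) / q * (1 - eS (X ω))⁻¹| ≤ 1 / q * δ⁻¹ := by
    filter_upwards [hall] with ω h
    obtain ⟨-, -, h1, h2, -, h3, h4⟩ := h
    have h6 : 0 < π (X ω) := hδ0.trans_le h1
    have h7 : 0 < 1 - eS (X ω) := hδ0.trans_le h4
    rw [abs_of_pos (by positivity)]
    gcongr
  have u1 : Integrable (fun ω => A ω * Y ω * (π (X ω) / q * (eS (X ω))⁻¹)) P := by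
    refine (hbnd P _ _ _ hAYi (g1m.comp hX) g1b).congr (Eventually.of_forall fun ω => ?_)
    exact mul_comm _ _
  have u0 : Integrable (fun ω => (1 - A ω) * Y ω * (π (X ω) / q * (1 - eS (X ω))⁻¹)) P := by
    refine (hbnd P _ _ _ hA'Yi (g0m.comp hX) g0b).congr (Eventually.of_forall fun ω => ?_)
    exact mul_comm _ _
  obtain ⟨w1, k1⟩ := cv_ext P X hX _ Y m₁ hA hA01 hm₁ _ g1m u1
  obtain ⟨w0, k0⟩ := cv_ext P X hX _ Y m₀ hA'm hA'01 hm₀ _ g0m u0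
  have hRm : Integrable (fun ω => R ω * (m₁ (X ω) - m₀ (X ω))) P :=
    hbnd P R _ 1 (hm₁i.sub hm₀i) hR (hRabs P)
  have hL : (∫ ω, (π (X ω) / q * (R ω * A ω * (Y ω - m₁ (X ω)) / eS (X ω)
            - (1 - A ω) * (Y ω - m₀ (X ω)) / (1 - eS (X ω)))
          + R ω / q * (m₁ (X ω) - m₀ (X ω))) ∂P) =
      ∫ ω, (m₁ (X ω) - m₀ (X ω)) ∂P1 := by
    calc _ = ∫ ω, (((A ω * Y ω * (π (X ω) / q * (eS (X ω))⁻¹)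
                - A ω * m₁ (X ω) * (π (X ω) / q * (eS (X ω))⁻¹))
              - ((1 - A ω) * Y ω * (π (X ω) / q * (1 - eS (X ω))⁻¹)
                - (1 - A ω) * m₀ (X ω) * (π (X ω) / q * (1 - eS (X ω))⁻¹)))
              + q⁻¹ * (R ω * (m₁ (X ω) - m₀ (X ω)))) ∂P := by
          refine integral_congr_ae ?_
          filter_upwards [hRA] with ω h
          simp only [div_eq_mul_inv]
          rw [h]; ring
      _ = _ := by
          have d1 : Integrable (fun ω => A ω * Y ω * (π (X ω) / q * (eS (X ω))⁻¹)
                - A ω * m₁ (X ω) * (π (X ω) / q * (eS (X ω))⁻¹)) P := u1.sub w1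
          have d0 : Integrable (fun ω => (1 - A ω) * Y ω * (π (X ω) / q * (1 - eS (X ω))⁻¹)
                - (1 - A ω) * m₀ (X ω) * (π (X ω) / q * (1 - eS (X ω))⁻¹)) P := u0.sub w0
          have d2 : Integrable (fun ω => (A ω * Y ω * (π (X ω) / q * (eS (X ω))⁻¹)
                - A ω * m₁ (X ω) * (π (X ω) / q * (eS (X ω))⁻¹))
              - ((1 - A ω) * Y ω * (π (X ω) / q * (1 - eS (X ω))⁻¹)
                - (1 - A ω) * m₀ (X ω) * (π (X ω) / q * (1 - eS (X ω))⁻¹))) P := d1.sub d0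
          rw [integral_add d2 (hRm.const_mul _),
            integral_sub d1 d0, integral_sub u1 w1, integral_sub u0 w0,
            k1, k0, integral_const_mul, hcond]
          ring
  have hRHS : ∫ ω, R ω / q * (μ₀ (X ω) - m₀ (X ω)) ∂P = ∫ ω, (μ₀ (X ω) - m₀ (X ω)) ∂P1 := by
    rw [hcond, ← integral_const_mul]
    congr 1; ext ω; ring
  rw [hL, hRHS, hτ, integral_sub (hint1 _ hm₁i) (hint1 _ hm₀i), integral_sub hμ₀i (hint1 _ hm₀i),
    integral_sub (hint1 _ hY1) (hint1 _ hY0), hE0, hE1]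
  ring
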